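/- Border rank is strictly subadditive under direct sum for tensors of every order at least four: let d ≥ 3 and let n, N be integers with 2n^{d−1} + n²(n+1)^{d−3} + 1 < N ≤ n^d. Let T₁ = Σ_{i₁,…,i_d=1}^{n} e_{i₁} ⊗ ⋯ ⊗ e_{i_d} ⊗ e_{(i₁,…,i_d)} ∈ (ℂ^n)^{⊗d} ⊗ ℂ^{n^d} and let T₂ = Σ_{j=1}^{N} e_j ⊗ e_j ⊗ e₀ ⊗ ⋯ ⊗ e₀ ∈ ℂ^N ⊗ ℂ^N ⊗ ℂ¹ ⊗ ⋯ ⊗ ℂ¹ (both tensors of order d+1). Then R̲(T₁ ⊕ T₂) < R̲(T₁) + R̲(T₂). -/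

import Mathlib

open Finset

namespace Subadditivity

noncomputable section

/-- A tensor of order `k` over `ℂ` with `i`-th factor the space `ℂ^{ι i}` of complex-valued
functions on the finite index type `ι i`; the tensor is represented by the array of its
coordinates with respect to the standard basis, i.e. by an element of
`ℂ^{ι 0} ⊗ ⋯ ⊗ ℂ^{ι (k-1)} ≃ ((∀ i, ι i) → ℂ)`. -/
abbrev Tensor {k : ℕ} (ι : Fin k → Type) : Type := (∀ i, ι i) → ℂ

/-- `T` is a sum of `r` simple (rank-one) tensors `v j 0 ⊗ ⋯ ⊗ v j (k-1)`. -/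
def HasRankLE {k : ℕ} {ι : Fin k → Type} (T : Tensor ι) (r : ℕ) : Prop :=
  ∃ v : Fin r → (∀ i, ι i → ℂ), T = fun x => ∑ j : Fin r, ∏ i : Fin k, v j i (x i)

/-- Tensor rank: the least `r` such that `T` is a sum of `r` simple tensors. -/
noncomputable def rank {k : ℕ} {ι : Fin k → Type} (T : Tensor ι) : ℕ :=
  sInf {r | HasRankLE T r}

/-- Border rank is at most `r`: `T` lies in the closure of the set of tensors of rank `≤ r`. -/
def HasBorderRankLE {k : ℕ} {ι : Fin k → Type} (T : Tensor ι) (r : ℕ) : Prop :=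
  T ∈ closure {S : Tensor ι | HasRankLE S r}

/-- Border rank. -/
noncomputable def borderRank {k : ℕ} {ι : Fin k → Type} (T : Tensor ι) : ℕ :=
  sInf {r | HasBorderRankLE T r}

open scoped Classical in
/-- Direct sum of two tensors of order `k`: the coordinates supported on the `ι`-part are
those of `T`, the coordinates supported on the `κ`-part are those of `S`, and all mixed
coordinates vanish. -/
noncomputable def dsum {k : ℕ} {ι κ : Fin k → Type} (T : Tensor ι) (S : Tensor κ) :
    Tensor (fun i => ι i ⊕ κ i) := fun x =>
  (if h : ∃ y : ∀ i, ι i, x = fun i => Sum.inl (y i) then T h.choose else 0) +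
  (if h : ∃ z : ∀ i, κ i, x = fun i => Sum.inr (z i) then S h.choose else 0)

/-- Kronecker product of two tensors of order `k`. -/
def kron {k : ℕ} {ι κ : Fin k → Type} (T : Tensor ι) (S : Tensor κ) :
    Tensor (fun i => ι i × κ i) := fun x =>
  T (fun i => (x i).1) * S (fun i => (x i).2)

/-- `N`-th Kronecker power of a tensor of order `k`. -/
def kpow {k : ℕ} {ι : Fin k → Type} (T : Tensor ι) (N : ℕ) :
    Tensor (fun i => Fin N → ι i) := fun x => ∏ j : Fin N, T (fun i => x i j)

/-- The unit tensor `u_k(r) = Σ_{j=1}^r e_j ⊗ ⋯ ⊗ e_j` of order `k`. -/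
def unit (k r : ℕ) : Tensor (fun _ : Fin k => Fin r) := fun x =>
  ∑ j : Fin r, ∏ i : Fin k, (if x i = j then (1 : ℂ) else 0)

/-- `S` is a degeneration of `T`: `S` lies in the closure of the set of tensors obtained
from `T` by applying linear maps `A i` on each factor. -/
def Degen {k : ℕ} {ι κ : Fin k → Type} [∀ i, Fintype (κ i)]
    (S : Tensor ι) (T : Tensor κ) : Prop :=
  S ∈ closure {S' : Tensor ι | ∃ A : ∀ i, ι i → κ i → ℂ,
    S' = fun x => ∑ y : ∀ i, κ i, (∏ i : Fin k, A i (x i) (y i)) * T y}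

/-- Kronecker delta. -/
def delta {α : Type} [DecidableEq α] (a b : α) : ℂ := if a = b then 1 else 0

/-- Factor index types of the order-`(d+1)` spider tensor: positions `0, …, d-1`
carry `ℂ^n`, and position `d` carries `ℂ^{n^d}`, indexed by `d`-tuples. -/
def famV (n d : ℕ) : Fin (d + 1) → Type :=
  fun i => if (i : ℕ) < d then Fin n else (Fin d → Fin n)

def vlow {n d : ℕ} {i : Fin (d + 1)} (h : (i : ℕ) < d) (u : famV n d i) : Fin n :=
  cast (by simp [famV, h]) u

def vhigh {n d : ℕ} {i : Fin (d + 1)} (h : ¬ (i : ℕ) < d) (u : famV n d i) :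
    Fin d → Fin n :=
  cast (by simp [famV, h]) u

/-- The order-`(d+1)` spider tensor
`T₁ = Σ_{i₁,…,i_d} e_{i₁} ⊗ ⋯ ⊗ e_{i_d} ⊗ e_{(i₁,…,i_d)} ∈ (ℂ^n)^{⊗d} ⊗ ℂ^{n^d}`. -/
def bigSpider (n d : ℕ) : Tensor (famV n d) := fun x =>
  ∏ j : Fin d, delta (α := Fin n)
    (vlow (i := Fin.castSucc j) (by simp) (x (Fin.castSucc j)))
    (vhigh (i := Fin.last d) (by simp) (x (Fin.last d)) j)

/-- Factor index types of the order-`(d+1)` tensor `T₂`: positions `0, 1` carry `ℂ^N`,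
all other positions carry `ℂ¹`. -/
def famW (N d : ℕ) : Fin (d + 1) → Type :=
  fun i => if (i : ℕ) < 2 then Fin N else Fin 1

def wlow {N d : ℕ} {i : Fin (d + 1)} (h : (i : ℕ) < 2) (u : famW N d i) : Fin N :=
  cast (by simp [famW, h]) u

/-- The order-`(d+1)` tensor `T₂ = Σ_{j=1}^N e_j ⊗ e_j ⊗ e₀ ⊗ ⋯ ⊗ e₀ ∈ ℂ^N ⊗ ℂ^N ⊗ ℂ¹ ⊗ ⋯ ⊗ ℂ¹`. -/
def bigMat (N d : ℕ) (hd : 1 ≤ d) : Tensor (famW N d) := fun x =>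
  delta (α := Fin N)
    (wlow (i := (⟨0, Nat.succ_pos d⟩ : Fin (d + 1))) (by simp) (x ⟨0, Nat.succ_pos d⟩))
    (wlow (i := (⟨1, by omega⟩ : Fin (d + 1))) (by simp) (x ⟨1, by omega⟩))

/-- The value at `o` of the point `z` extended by the value `1` at `none`. -/
def affineCoord {α R : Type*} [One R] (z : α → R) (o : Option α) : R := o.elim 1 z

/-- The exponent of the monomial obtained from a multiset of variables by setting `none` to `1`. -/
def dehomExp {α : Type*} (s : Multiset (Option α)) : α →₀ ℕ :=
  (s.map fun o => o.elim 0 fun i => Finsupp.single i 1).sum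

theorem dehomExp_apply {α : Type*} [DecidableEq α] (s : Multiset (Option α)) (i : α) :
    dehomExp s i = s.count (some i) := by
  induction s using Multiset.induction_on with
  | empty => simp [dehomExp]
  | cons a s ih =>
    have h : dehomExp (a ::ₘ s) = (a.elim 0 fun i => Finsupp.single i 1) + dehomExp s := by
      simp [dehomExp]
    rw [h, Finsupp.add_apply, ih, Multiset.count_cons]
    cases a with
    | none => simp
    | some j => simp [Finsupp.single_apply, add_comm, eq_comm]

theorem dehomExp_injOn_card {α : Type*} [DecidableEq α] {s t : Multiset (Option α)}
    (hc : s.card = t.card) (h : dehomExp s = dehomExp t) : s = t := by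
  have hsome : ∀ i, s.count (some i) = t.count (some i) := fun i => by
    rw [← dehomExp_apply, ← dehomExp_apply, h]
  have hfilter : s.filter (· ≠ none) = t.filter (· ≠ none) := by
    ext o
    cases o <;> simp [hsome]
  have hcount : ∀ u : Multiset (Option α), (u.filter (· ≠ none)).card + u.count none = u.card := by
    intro u
    induction u using Multiset.induction_on with
    | empty => simp
    | cons a u ih => cases a <;> simp_all <;> omega
  have hs := hcount s
  have ht := hcount t
  rw [hfilter] at hs
  ext o
  cases o with
  | none => omega
  | some i => exact hsome i

theorem prod_affineCoord_X {α : Type*} (s : Multiset (Option α)) :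
    (s.map (affineCoord (MvPolynomial.X : α → MvPolynomial α ℂ))).prod =
      MvPolynomial.monomial (dehomExp s) 1 := by
  induction s using Multiset.induction_on with
  | empty => simp [dehomExp]
  | cons a s ih =>
    rw [Multiset.map_cons, Multiset.prod_cons, ih]
    cases a with
    | none => simp [affineCoord, dehomExp]
    | some j => simp [affineCoord, dehomExp, MvPolynomial.X, MvPolynomial.monomial_mul]

theorem eval_prod_affineCoord_X {α : Type*} (z : α → ℂ) (s : Multiset (Option α)) :
    MvPolynomial.eval z (s.map (affineCoord MvPolynomial.X)).prod =
      (s.map (affineCoord z)).prod := by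
  rw [map_multiset_prod, Multiset.map_map]
  congr 2
  ext o
  cases o <;> simp [affineCoord]

theorem linearIndependent_prod_affineCoord_X {α : Type*} [DecidableEq α] (m : ℕ) :
    LinearIndependent ℂ fun s : Sym (Option α) m =>
      ((s : Multiset (Option α)).map
        (affineCoord (MvPolynomial.X : α → MvPolynomial α ℂ))).prod := by
  simp_rw [prod_affineCoord_X]
  have h := (MvPolynomial.basisMonomials α ℂ).linearIndependent.comp
    (fun s : Sym (Option α) m => dehomExp (s : Multiset (Option α)))
    (fun s t hst => Sym.coe_injective
      (dehomExp_injOn_card (by rw [Sym.card_coe, Sym.card_coe]) hst))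
  simpa [Function.comp_def] using h

/-- Points at which evaluation of a linearly independent family of polynomials is invertible. -/
theorem exists_basis_eval {α ι : Type*} [Fintype ι] [DecidableEq ι] {p : ι → MvPolynomial α ℂ}
    (hp : LinearIndependent ℂ p) :
    ∃ (z : ι → α → ℂ) (B : Module.Basis ι ℂ (ι → ℂ)),
      ∀ j, B j = fun s => MvPolynomial.eval (z j) (p s) := by
  set ev : (α → ℂ) → ι → ℂ := fun z s => MvPolynomial.eval z (p s) with hev
  have hspan : Submodule.span ℂ (Set.range ev) = ⊤ := by
    by_contra hne
    obtain ⟨f, hf, hle⟩ := Submodule.exists_le_ker_of_lt_top _ (lt_top_iff_ne_top.2 hne)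
    apply hf
    have hpoly : ∑ s, f (Pi.single s 1) • p s = 0 := by
      apply MvPolynomial.funext
      intro z
      have h0 : f (ev z) = 0 := hle (Submodule.subset_span ⟨z, rfl⟩)
      rw [LinearMap.pi_apply_eq_sum_univ f (ev z)] at h0
      rw [map_sum, map_zero, ← h0]
      refine sum_congr rfl fun s _ => ?_
      simp only [MvPolynomial.smul_eval, smul_eq_mul, hev]
      rw [mul_comm]
      congr 2
      ext j
      simp [Pi.single_apply, eq_comm]
    have hz := Fintype.linearIndependent_iff.1 hp _ hpoly
    apply LinearMap.pi_ext'
    intro s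
    ext
    simpa using hz s
  obtain ⟨b, hb, hbs, hbi⟩ := exists_linearIndependent ℂ (Set.range ev)
  let B₀ : Module.Basis b ℂ (ι → ℂ) := Module.Basis.mk hbi (by simp [hbs, hspan])
  let e : b ≃ ι := B₀.indexEquiv (Pi.basisFun ℂ ι)
  choose z hz using fun j : ι => hb (e.symm j).2
  refine ⟨z, B₀.reindex e, fun j => ?_⟩
  rw [Module.Basis.reindex_apply, Module.Basis.mk_apply, ← hz j]

/-- Some evaluation vector has all its coordinates nonzero in a given basis. -/
theorem exists_eval_coord_ne_zero {α ι : Type*} [Fintype ι] [DecidableEq ι]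
    {p : ι → MvPolynomial α ℂ} (hp : LinearIndependent ℂ p) (B : Module.Basis ι ℂ (ι → ℂ)) :
    ∃ z : α → ℂ, ∀ j, B.repr (fun s => MvPolynomial.eval z (p s)) j ≠ 0 := by
  set L : ι → MvPolynomial α ℂ := fun j => ∑ s, B.repr (Pi.single s 1) j • p s with hL
  have hLne : ∀ j, L j ≠ 0 := by
    intro j hj
    have hz := Fintype.linearIndependent_iff.1 hp _ hj
    have hcoord : B.coord j = 0 := by
      apply LinearMap.pi_ext'
      intro s
      ext
      simpa using hz s
    have h1 : B.coord j (B j) = 1 := by simp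
    rw [hcoord] at h1
    simp at h1
  have hprod : ∏ j, L j ≠ 0 := prod_ne_zero_iff.2 fun j _ => hLne j
  obtain ⟨z, hz⟩ : ∃ z, MvPolynomial.eval z (∏ j, L j) ≠ 0 := by
    by_contra! h
    exact hprod (MvPolynomial.funext fun z => by rw [h z, map_zero])
  refine ⟨z, fun j hj => hz ?_⟩
  rw [map_prod]
  refine prod_eq_zero (mem_univ j) ?_
  rw [← hj]
  change _ = B.coord j _
  rw [LinearMap.pi_apply_eq_sum_univ (B.coord j)]
  simp only [hL, map_sum, MvPolynomial.smul_eval, smul_eq_mul, Module.Basis.coord_apply]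
  refine sum_congr rfl fun s _ => ?_
  rw [mul_comm]
  congr 3
  ext j
  simp [Pi.single_apply, eq_comm]

/-- Coordinate vectors span a complement of any subspace of a coordinate space. -/
theorem exists_finset_complement {Z : Type*} [Fintype Z] [DecidableEq Z]
    (W : Submodule ℂ (Z → ℂ)) :
    ∃ R : Finset Z, R.card + Module.finrank ℂ W = Fintype.card Z ∧
      ∀ f : Z → ℂ, ∃ h : R → ℂ, f - ∑ r : R, h r • Pi.single (r : Z) (1 : ℂ) ∈ W := by
  classical
  set v : Z → (Z → ℂ) ⧸ W := fun r => W.mkQ (Pi.single r 1) with hv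
  have hspan : Submodule.span ℂ (Set.range v) = ⊤ := by
    have : Set.range v = W.mkQ '' Set.range (Pi.basisFun ℂ Z) := by
      rw [← Set.range_comp]; congr 1; ext r; simp [hv]
    rw [this, ← Submodule.map_span, Module.Basis.span_eq, Submodule.map_top,
      Submodule.range_mkQ]
  obtain ⟨κ, a, ha, hsp, hli⟩ := exists_linearIndependent' ℂ v
  have : Finite κ := Finite.of_injective a ha
  have := Fintype.ofFinite κ
  rw [hspan] at hsp
  let B := Module.Basis.mk hli hsp.ge
  refine ⟨univ.map ⟨a, ha⟩, ?_, fun f => ?_⟩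
  · rw [card_map, card_univ, ← Module.finrank_eq_card_basis B,
      Submodule.finrank_quotient_add_finrank]
    simp
  · let e : κ ≃ (univ.map ⟨a, ha⟩ : Finset Z) :=
      Equiv.ofBijective (fun k => ⟨a k, by simp⟩)
        ⟨fun x y h => ha (by simpa using h), fun ⟨r, hr⟩ => by
          obtain ⟨k, -, rfl⟩ := Finset.mem_map.1 hr
          exact ⟨k, rfl⟩⟩
    refine ⟨fun r => B.repr (W.mkQ f) (e.symm r), ?_⟩
    rw [← Submodule.Quotient.mk_eq_zero, ← Submodule.mkQ_apply, map_sub, map_sum, sub_eq_zero,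
      ← e.sum_comp]
    conv_lhs => rw [← B.sum_repr (W.mkQ f)]
    refine sum_congr rfl fun k _ => ?_
    rw [map_smul]
    beta_reduce
    rw [Equiv.symm_apply_apply, Module.Basis.mk_apply]
    rfl

theorem exists_sym_prod_eq {β : Type*} {m : ℕ} (s : Fin m → β) :
    ∃ t : Sym β m, ∀ f : β → ℂ, ((t : Multiset β).map f).prod = ∏ x, f (s x) :=
  ⟨⟨univ.val.map s, by simp⟩, fun f => by
    simp only [Sym.coe_mk, Multiset.map_map, Finset.prod, Function.comp_def]⟩

theorem exists_fun_prod_eq {β : Type*} {m : ℕ} (t : Sym β m) :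
    ∃ s : Fin m → β, (∀ b ∈ (t : Multiset β), ∃ x, s x = b) ∧
      ∀ f : β → ℂ, ((t : Multiset β).map f).prod = ∏ x, f (s x) := by
  obtain ⟨t, ht⟩ := t
  induction t using Quotient.inductionOn with
  | h l =>
    subst ht
    have hl : univ.val.map l.get = (l : Multiset β) := by
      rw [Fin.univ_val_map, List.ofFn_get]
    refine ⟨l.get, fun b hb => ?_, fun f => ?_⟩
    · change b ∈ (l : Multiset β) at hb
      exact List.mem_iff_get.1 (by simpa using hb)
    · change (Multiset.map f (l : Multiset β)).prod = _
      rw [← hl, Multiset.map_map]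
      rfl

theorem exists_sym_prod_affineCoord_eq {α : Type*} [DecidableEq α] {k : ℕ}
    (s : Fin (k + 1) → Option α) (hs : ∃ x, s x = none) :
    ∃ t : Sym (Option α) k, ∀ z : α → ℂ,
      ((t : Multiset (Option α)).map (affineCoord z)).prod = ∏ x, affineCoord z (s x) := by
  obtain ⟨x, hx⟩ := hs
  obtain ⟨t, ht⟩ := exists_sym_prod_eq fun y => s (x.succAbove y)
  refine ⟨t, fun z => ?_⟩
  rw [ht, Fin.prod_univ_succAbove _ x, hx]
  simp [affineCoord]

/-- The evaluations of products of affine coordinates at suitable points, together with coordinate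
vectors, interpolate every coordinate vector by combinations killing the lower-order products. -/
theorem exists_interpolation (n k : ℕ) :
    ∃ (z : Sym (Option (Fin n)) (k + 1) → Fin n → ℂ) (z₀ : Fin n → ℂ)
      (c : Sym (Option (Fin n)) (k + 1) → ℂ) (R : Finset (Fin (k + 1) → Fin n))
      (q : Sym (Option (Fin n)) (k + 1) → (Fin (k + 1) → Fin n) → ℂ)
      (h : R → (Fin (k + 1) → Fin n) → ℂ),
      (∀ j, c j ≠ 0) ∧
      (∀ s : Fin (k + 1) → Option (Fin n),
        ∑ j, c j * ∏ x, affineCoord (z j) (s x) = ∏ x, affineCoord z₀ (s x)) ∧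
      (∀ (s : Fin (k + 1) → Option (Fin n)) (y : Fin (k + 1) → Fin n), (∃ x, s x = none) →
        ∑ j, q j y * ∏ x, affineCoord (z j) (s x) = 0) ∧
      (∀ w y : Fin (k + 1) → Fin n,
        ∑ j, q j y * ∏ x, z j (w x) + ∑ r : R, (if w = r then 1 else 0) * h r y =
          if w = y then 1 else 0) ∧
      R.card + Fintype.card (Sym (Option (Fin n)) (k + 1)) ≤
        n ^ (k + 1) + Fintype.card (Sym (Option (Fin n)) k) := by
  classical
  have hp := linearIndependent_prod_affineCoord_X (α := Fin n) (k + 1)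
  obtain ⟨z, B, hB⟩ := exists_basis_eval hp
  obtain ⟨z₀, hz₀⟩ := exists_eval_coord_ne_zero hp B
  simp only [eval_prod_affineCoord_X] at hB hz₀
  let low : (Sym (Option (Fin n)) (k + 1) → ℂ) →ₗ[ℂ] (Sym (Option (Fin n)) k → ℂ) :=
    Fintype.linearCombination ℂ fun j s =>
      ((s : Multiset (Option (Fin n))).map (affineCoord (z j))).prod
  let top : (Sym (Option (Fin n)) (k + 1) → ℂ) →ₗ[ℂ] ((Fin (k + 1) → Fin n) → ℂ) :=
    Fintype.linearCombination ℂ fun j w => ∏ x, z j (w x)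
  have hlow : ∀ a ∈ LinearMap.ker low, ∀ s : Fin (k + 1) → Option (Fin n), (∃ x, s x = none) →
      ∑ j, a j * ∏ x, affineCoord (z j) (s x) = 0 := by
    intro a ha s hs
    obtain ⟨t, ht⟩ := exists_sym_prod_affineCoord_eq s hs
    have := congrFun (LinearMap.mem_ker.1 ha) t
    simpa [low, Fintype.linearCombination_apply, Finset.sum_apply, ht] using this
  have hinj : Function.Injective (top.domRestrict (LinearMap.ker low)) := by
    rw [← LinearMap.ker_eq_bot, LinearMap.ker_eq_bot']
    rintro ⟨a, ha⟩ h0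
    have hsum : ∑ j, a j • B j = 0 := by
      ext t
      obtain ⟨s, -, hs⟩ := exists_fun_prod_eq t
      simp only [hB, Finset.sum_apply, Pi.smul_apply, smul_eq_mul, Pi.zero_apply, hs]
      by_cases hex : ∃ x, s x = none
      · exact hlow a ha s hex
      · push Not at hex
        choose w hw using fun x => Option.ne_none_iff_exists'.1 (hex x)
        have := congrFun h0 w
        simpa [top, Fintype.linearCombination_apply, Finset.sum_apply, hw, affineCoord] using this
    have := Fintype.linearIndependent_iff.1 B.linearIndependent a hsum
    ext j
    exact this j
  set W := (LinearMap.ker low).map top with hW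
  have hWrank : Fintype.card (Sym (Option (Fin n)) (k + 1)) ≤
      Module.finrank ℂ W + Fintype.card (Sym (Option (Fin n)) k) := by
    have h1 : Module.finrank ℂ W = Module.finrank ℂ (LinearMap.ker low) := by
      rw [hW, ← LinearMap.range_domRestrict]
      exact LinearMap.finrank_range_of_inj hinj
    have h2 := low.finrank_range_add_finrank_ker
    have h3 := Submodule.finrank_le (LinearMap.range low)
    rw [Module.finrank_fintype_fun_eq_card] at h2 h3
    omega
  obtain ⟨R, hR, hcompl⟩ := exists_finset_complement W
  choose h hh using fun y => hcompl (Pi.single y 1)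
  choose a ha hatop using fun y => Submodule.mem_map.1 (hh y)
  refine ⟨z, z₀, B.repr _, R, fun j y => a y j, fun r y => h y r, hz₀, fun s => ?_,
    fun s y hs => ?_, fun w y => ?_, ?_⟩
  · obtain ⟨t, ht⟩ := exists_sym_prod_eq s
    have := congrFun (B.sum_repr fun s : Sym (Option (Fin n)) (k + 1) =>
      ((s : Multiset (Option (Fin n))).map (affineCoord z₀)).prod) t
    simpa [hB, Finset.sum_apply, ht] using this
  · exact hlow (a y) (ha y) s hs
  · have := congrFun (hatop y) w
    simp only [top, Fintype.linearCombination_apply, Finset.sum_apply, Pi.smul_apply,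
      smul_eq_mul, Pi.sub_apply, Pi.single_apply] at this
    rw [this]
    simp [mul_comm]
  · have hcard : Fintype.card (Fin (k + 1) → Fin n) = n ^ (k + 1) := by simp
    omega

/-- Two families of vectors, with vanishing sums along the first and the second index
respectively, whose pairing is a partial identity of rank `min N (p ^ 2 * card Q)`. -/
theorem exists_zero_sum_families (p N : ℕ) (Q : Type*) [Fintype Q] :
    ∃ u v : Fin (p + 1) → Fin (p + 1) → Q → Fin N → ℂ,
      (∀ j J b, ∑ i, u i j J b = 0) ∧ (∀ i J b, ∑ j, v i j J b = 0) ∧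
      ∀ b b', ∑ i, ∑ j, ∑ J, u i j J b * v i j J b' =
        if b = b' ∧ (b : ℕ) < p ^ 2 * Fintype.card Q then 1 else 0 := by
  classical
  let e : Fin p × Fin p × Q ≃ Fin (p ^ 2 * Fintype.card Q) :=
    Fintype.equivFinOfCardEq (by simp [pow_two, mul_assoc])
  let U : Fin p → Fin p → Q → Fin N → ℂ :=
    fun i j J b => if (e (i, j, J) : ℕ) = b then 1 else 0
  let u : Fin (p + 1) → Fin (p + 1) → Q → Fin N → ℂ := fun i j J b =>
    Fin.lastCases 0 (fun j' => Fin.lastCases (-∑ i', U i' j' J b) (fun i' => U i' j' J b) i) j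
  let v : Fin (p + 1) → Fin (p + 1) → Q → Fin N → ℂ := fun i j J b =>
    Fin.lastCases 0 (fun i' => Fin.lastCases (-∑ j', U i' j' J b) (fun j' => U i' j' J b) j) i
  refine ⟨u, v, fun j J b => ?_, fun i J b => ?_, fun b b' => ?_⟩
  · induction j using Fin.lastCases <;> simp [u, Fin.sum_univ_castSucc]
  · induction i using Fin.lastCases <;> simp [v, Fin.sum_univ_castSucc]
  · simp only [Fin.sum_univ_castSucc, u, v, Fin.lastCases_castSucc, Fin.lastCases_last, mul_zero,
      zero_mul, sum_const_zero, add_zero]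
    have hs : ∑ i, ∑ j, ∑ J, U i j J b * U i j J b' =
        ∑ x : Fin (p ^ 2 * Fintype.card Q),
          (if (x : ℕ) = b then (1 : ℂ) else 0) * (if (x : ℕ) = b' then 1 else 0) := by
      rw [← e.sum_comp, Fintype.sum_prod_type]
      simp only [Fintype.sum_prod_type, U]
    rw [hs]
    by_cases hb : (b : ℕ) < p ^ 2 * Fintype.card Q
    · rw [sum_eq_single ⟨b, hb⟩]
      · simp [hb, Fin.ext_iff]
      · intro x _ hx
        rw [if_neg fun h => hx (Fin.ext h), zero_mul]
      · simp
    · rw [if_neg fun h => hb h.2]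
      refine sum_eq_zero fun x _ => ?_
      rw [if_neg fun h : (x : ℕ) = b => hb (h ▸ x.2), zero_mul]

theorem choose_add_le_pow (n k : ℕ) : (n + k).choose k ≤ (n + 1) ^ k := by
  induction k with
  | zero => simp
  | succ k ih =>
    have h := Nat.add_one_mul_choose_eq (n + k) k
    have h2 : (n + k + 1).choose (k + 1) * (k + 1) ≤ (n + 1) ^ (k + 1) * (k + 1) := by
      rw [← h, pow_succ]
      calc (n + k + 1) * (n + k).choose k ≤ ((n + 1) * (k + 1)) * (n + 1) ^ k := by
            gcongr
            nlinarith [Nat.zero_le (n * k)]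
        _ = _ := by ring
    exact Nat.le_of_mul_le_mul_right h2 k.succ_pos

theorem pow_mul_quadratic_le (n k : ℕ) :
    (n : ℤ) ^ k * (2 * n ^ 2 + 2 * n * k + k * (k - 1)) ≤ 2 * n ^ 2 * (n + 1) ^ k := by
  induction k with
  | zero => simp
  | succ k ih =>
    have h := mul_le_mul_of_nonneg_left ih (by positivity : (0 : ℤ) ≤ n + 1)
    have hk : (0 : ℤ) ≤ k * (k - 1) := by
      rcases k with _ | k
      · simp
      · push_cast; nlinarith [Nat.zero_le k, Int.natCast_nonneg k]
    have h2 : (0 : ℤ) ≤ (n : ℤ) ^ k * (k * (k - 1)) := by positivity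
    push_cast
    calc _ = (n + 1) * ((n : ℤ) ^ k * (2 * n ^ 2 + 2 * n * k + k * (k - 1)))
          - (n : ℤ) ^ k * (k * (k - 1)) := by ring
      _ ≤ _ := by rw [pow_succ ((n : ℤ) + 1)]; linarith

theorem degree_bound {n k N : ℕ}
    (h₁ : 2 * n ^ (k + 2) + n ^ 2 * (n + 1) ^ k + 1 < N) (h₂ : N ≤ n ^ (k + 3)) :
    4 ≤ n ∧ (2 * n - 1 : ℤ) * (k + 1) + 2 ≤ n * (n - 1) ^ 2 := by
  have hn : 0 < n := Nat.pos_of_ne_zero fun h => by subst h; simp at h₂; omega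
  have hlt : 2 * n ^ (k + 2) + n ^ 2 * (n + 1) ^ k < n ^ (k + 3) := by omega
  zify at hlt
  have hq := pow_mul_quadratic_le n k
  have hnk : (0 : ℤ) < (n : ℤ) ^ k := by positivity
  have hquad : (2 * n ^ 2 + 2 * n * k + k * (k - 1) : ℤ) < 2 * n ^ 2 * (n - 2) := by
    refine lt_of_mul_lt_mul_left (a := (n : ℤ) ^ k) ?_ hnk.le
    calc _ ≤ _ := hq
      _ < _ := by
        have e1 : (n : ℤ) ^ (k + 2) = n ^ k * n ^ 2 := pow_add _ _ _
        have e2 : (n : ℤ) ^ (k + 3) = n ^ k * n ^ 3 := pow_add _ _ _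
        rw [e1, e2] at hlt
        linarith
  have hk : (0 : ℤ) ≤ k * (k - 1) := by
    rcases k with _ | k
    · simp
    · push_cast; nlinarith [Int.natCast_nonneg k]
  have hn4 : 4 ≤ n := by
    by_contra! h
    interval_cases n <;> push_cast at hquad <;> nlinarith [Int.natCast_nonneg k]
  refine ⟨hn4, ?_⟩
  by_contra! hcon
  have hn4' : (4 : ℤ) ≤ n := by exact_mod_cast hn4
  generalize (n : ℤ) = x at *
  have hk0 : (0 : ℤ) ≤ k := Int.natCast_nonneg k
  generalize (k : ℤ) = y at *
  have hy : 2 * x ^ 2 - 3 * x ≤ 4 * (y + 1) := by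
    by_contra! h
    nlinarith
  have hx : 0 ≤ 2 * x ^ 2 - 3 * x - 8 := by nlinarith
  have h3 : (2 * x ^ 2 - 3 * x - 4) * (2 * x ^ 2 - 3 * x - 8) ≤ 4 * y * (4 * y - 4) := by
    apply mul_le_mul <;> linarith
  have h4 : 0 ≤ x * (4 * y - (2 * x ^ 2 - 3 * x - 4)) := by
    apply mul_nonneg <;> linarith
  nlinarith [sq_nonneg (x * (2 * x - 7)), sq_nonneg x]

theorem choose_bounds {p k N : ℕ}
    (h₁ : 2 * (p + 1) ^ (k + 2) + (p + 1) ^ 2 * (p + 1 + 1) ^ k + 1 < N)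
    (h₂ : N ≤ (p + 1) ^ (k + 3)) :
    (p + 1) ^ 2 * (p + 1 + k).choose k + 1 < N ∧
      (p + 1) ^ 2 * (p + 1 + k).choose k + 1 < p ^ 2 * (p + 1 + k + 1).choose (k + 1) := by
  constructor
  · have := Nat.mul_le_mul_left ((p + 1) ^ 2) (choose_add_le_pow (p + 1) k)
    omega
  · obtain ⟨-, hdeg⟩ := degree_bound h₁ h₂
    have hL : k + 1 ≤ (p + 1 + k).choose k := by
      calc k + 1 = (k + 1).choose k := (Nat.choose_succ_self_right k).symm
        _ ≤ _ := Nat.choose_le_choose k (by omega)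
    have hM := Nat.add_one_mul_choose_eq (p + 1 + k) k
    generalize (p + 1 + k).choose k = L at *
    generalize (p + 1 + k + 1).choose (k + 1) = M at *
    refine Nat.lt_of_mul_lt_mul_right (a := k + 1) ?_
    rw [mul_assoc (p ^ 2), ← hM]
    zify at hL ⊢
    push_cast at hdeg
    have h5 := mul_le_mul_of_nonneg_right hdeg (Int.natCast_nonneg L)
    nlinarith

theorem HasRankLE.of_fintype {k : ℕ} {ι : Fin k → Type} {κ : Type*} [Fintype κ]
    (v : κ → ∀ i, ι i → ℂ) :
    HasRankLE (fun x : ∀ i, ι i => ∑ j, ∏ i, v j i (x i)) (Fintype.card κ) :=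
  ⟨fun j => v ((Fintype.equivFin κ).symm j), funext fun x =>
    ((Fintype.equivFin κ).symm.sum_comp fun j => ∏ i, v j i (x i)).symm⟩

theorem exists_hasBorderRankLE {k : ℕ} {ι : Fin (k + 1) → Type} [∀ i, Finite (ι i)]
    (T : Tensor ι) : ∃ r, HasBorderRankLE T r := by
  classical
  have := fun i => Fintype.ofFinite (ι i)
  have h := HasRankLE.of_fintype fun (y : ∀ i, ι i) (i : Fin (k + 1)) (u : ι i) =>
    (if i = 0 then T y else 1) * if u = y i then 1 else 0
  refine ⟨_, subset_closure (s := {S : Tensor ι | HasRankLE S (Fintype.card (∀ i, ι i))}) ?_⟩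
  rw [Set.mem_ofPred_eq]
  convert h using 1
  funext x
  have hb (y : ∀ i, ι i) : ∏ i, (if x i = y i then (1 : ℂ) else 0) = if x = y then 1 else 0 := by
    rw [Fintype.prod_boole]
    simp only [← funext_iff]
  simp_rw [prod_mul_distrib, hb]
  simp

/-- The flattening lower bound for border rank, for a flattening with an identity submatrix. -/
theorem card_le_of_hasBorderRankLE {k : ℕ} {ι : Fin k → Type} {κ : Type*} [Fintype κ]
    [DecidableEq κ] (P : Fin k → Prop) [DecidablePred P] (f g : κ → ∀ i, ι i) {T : Tensor ι}
    (hT : ∀ a b, T (fun i => if P i then f a i else g b i) = if a = b then 1 else 0) {r : ℕ}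
    (hr : HasBorderRankLE T r) : Fintype.card κ ≤ r := by
  by_contra! hlt
  let mat : Tensor ι → Matrix κ κ ℂ := fun S => Matrix.of fun a b =>
    S fun i => if P i then f a i else g b i
  have hclosed : IsClosed {S : Tensor ι | (mat S).det = 0} := by
    refine isClosed_eq (Continuous.matrix_det ?_) continuous_const
    exact continuous_matrix fun a b => continuous_apply _
  have hsub : {S : Tensor ι | HasRankLE S r} ⊆ {S : Tensor ι | (mat S).det = 0} := by
    rintro S ⟨v, rfl⟩
    let A : Matrix κ (Fin r) ℂ := Matrix.of fun a j => ∏ i with P i, v j i (f a i)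
    let B : Matrix (Fin r) κ ℂ := Matrix.of fun j b => ∏ i with ¬ P i, v j i (g b i)
    have hAB : mat (fun x => ∑ j, ∏ i, v j i (x i)) = A * B := by
      ext a b
      simp only [mat, A, B, Matrix.mul_apply, Matrix.of_apply]
      refine sum_congr rfl fun j _ => ?_
      rw [← prod_filter_mul_prod_filter_not univ P]
      congr 1 <;> refine prod_congr rfl fun i hi => ?_
      · rw [if_pos (mem_filter.1 hi).2]
      · rw [if_neg (mem_filter.1 hi).2]
    rw [Set.mem_ofPred_eq, hAB]
    by_contra hdet
    have hu : IsUnit (A * B) := (Matrix.isUnit_iff_isUnit_det _).2 (Ne.isUnit hdet)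
    have h1 := Matrix.rank_of_isUnit _ hu
    have h2 := (Matrix.rank_mul_le_left A B).trans (Matrix.rank_le_card_width A)
    rw [Fintype.card_fin] at h2
    omega
  have h0 : (mat T).det = 0 := hclosed.closure_subset_iff.2 hsub hr
  have h1 : mat T = 1 := by
    ext a b
    simp [mat, hT, Matrix.one_apply]
  rw [h1, Matrix.det_one] at h0
  exact one_ne_zero h0

theorem card_le_borderRank {k : ℕ} {ι : Fin (k + 1) → Type} [∀ i, Finite (ι i)] {κ : Type*}
    [Fintype κ] [DecidableEq κ] (P : Fin (k + 1) → Prop) [DecidablePred P] (f g : κ → ∀ i, ι i)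
    {T : Tensor ι}
    (hT : ∀ a b, T (fun i => if P i then f a i else g b i) = if a = b then 1 else 0) :
    Fintype.card κ ≤ borderRank T :=
  card_le_of_hasBorderRankLE P f g hT (Nat.sInf_mem (exists_hasBorderRankLE T))

instance (n d : ℕ) (i : Fin (d + 1)) : Finite (famV n d i) := by
  unfold famV; split <;> infer_instance

instance (N d : ℕ) (i : Fin (d + 1)) : Finite (famW N d i) := by
  unfold famW; split <;> infer_instance

theorem pow_le_borderRank_bigSpider (n d : ℕ) : n ^ d ≤ borderRank (bigSpider n d) := by
  let f : (Fin d → Fin n) → ∀ i, famV n d i := fun a i =>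
    if h : (i : ℕ) < d then cast (by simp [famV, h]) (a ⟨i, h⟩) else cast (by simp [famV, h]) a
  have h := card_le_borderRank (T := bigSpider n d) (fun i => (i : ℕ) < d) f f fun a b => by
    simp only [bigSpider, f, delta, vlow, vhigh, Fin.val_castSucc, Fin.is_lt, Fin.val_last,
      lt_self_iff_false, if_true, if_false, dite_true, dite_false, cast_cast, cast_eq,
      Fintype.prod_boole, Fin.eta, ← funext_iff]
  simpa using h

theorem le_borderRank_bigMat (N d : ℕ) (hd : 1 ≤ d) : N ≤ borderRank (bigMat N d hd) := by
  let f : Fin N → ∀ i, famW N d i := fun a i =>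
    if h : (i : ℕ) < 2 then cast (by simp [famW, h]) a else cast (by simp [famW, h]) (0 : Fin 1)
  have h := card_le_borderRank (T := bigMat N d hd) (fun i => (i : ℕ) = 0) f f fun a b => by
    simp only [bigMat, f, delta, wlow, Nat.zero_lt_two, Nat.one_lt_two, one_ne_zero, if_true,
      if_false, dite_true, cast_cast, cast_eq]
  simpa using h

section dsum

variable {k : ℕ} {ι κ : Fin k → Type} (T : Tensor ι) (S : Tensor κ)

theorem dsum_inl [NeZero k] (y : ∀ i, ι i) : dsum T S (fun i => Sum.inl (y i)) = T y := by
  have h : ∃ y' : ∀ i, ι i, (fun i => (Sum.inl (y i) : ι i ⊕ κ i)) = fun i => Sum.inl (y' i) :=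
    ⟨y, rfl⟩
  have hy : h.choose = y := funext fun i => (Sum.inl_injective (congrFun h.choose_spec i)).symm
  rw [dsum, dif_pos h, dif_neg, hy, add_zero]
  rintro ⟨z, hz⟩
  exact Sum.inl_ne_inr (congrFun hz 0)

theorem dsum_inr [NeZero k] (z : ∀ i, κ i) : dsum T S (fun i => Sum.inr (z i)) = S z := by
  have h : ∃ z' : ∀ i, κ i, (fun i => (Sum.inr (z i) : ι i ⊕ κ i)) = fun i => Sum.inr (z' i) :=
    ⟨z, rfl⟩
  have hz : h.choose = z := funext fun i => (Sum.inr_injective (congrFun h.choose_spec i)).symm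
  rw [dsum, dif_neg, dif_pos h, hz, zero_add]
  rintro ⟨y, hy⟩
  exact Sum.inr_ne_inl (congrFun hy 0)

theorem dsum_eq_zero {x : ∀ i, ι i ⊕ κ i} (hl : ¬ ∀ i, (x i).isLeft) (hr : ¬ ∀ i, (x i).isRight) :
    dsum T S x = 0 := by
  rw [dsum, dif_neg, dif_neg, add_zero]
  · rintro ⟨z, rfl⟩
    exact hr fun i => rfl
  · rintro ⟨y, rfl⟩
    exact hl fun i => rfl

end dsum

section coordinates

variable {n N m : ℕ}

/-- The coordinate of an index of the direct sum in one of the first two factors. -/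
def lowIdx {i : Fin (m + 2 + 1)} (h : (i : ℕ) < 2) :
    famV n (m + 2) i ⊕ famW N (m + 2) i → Fin n ⊕ Fin N :=
  Sum.map (vlow (by omega)) (wlow h)

/-- The coordinate of an index of the direct sum in a middle factor, where `none` is the basis
vector of `ℂ¹`. -/
def midIdx {i : Fin (m + 2 + 1)} (h : (i : ℕ) < m + 2) :
    famV n (m + 2) i ⊕ famW N (m + 2) i → Option (Fin n) :=
  Sum.elim (fun y => some (vlow h y)) fun _ => none

/-- The coordinate of an index of the direct sum in the last factor, where `none` is the basis
vector of `ℂ¹`. -/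
def lastIdx {i : Fin (m + 2 + 1)} (h : ¬ (i : ℕ) < m + 2) :
    famV n (m + 2) i ⊕ famW N (m + 2) i → Option (Fin n × Fin n × (Fin m → Fin n)) :=
  Sum.elim (fun y => some (vhigh h y 0, vhigh h y 1, fun k => vhigh h y k.succ.succ)) fun _ => none

/-- The vectors of a simple tensor, given by functions of the coordinates. -/
def simpleVec (a b : Fin n ⊕ Fin N → ℂ) (p : Fin m → Option (Fin n) → ℂ)
    (l : Option (Fin n × Fin n × (Fin m → Fin n)) → ℂ) (i : Fin (m + 2 + 1))
    (x : famV n (m + 2) i ⊕ famW N (m + 2) i) : ℂ :=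
  if h₀ : (i : ℕ) = 0 then a (lowIdx (by omega) x)
  else if h₁ : (i : ℕ) = 1 then b (lowIdx (by omega) x)
  else if h : (i : ℕ) < m + 2 then p ⟨i - 2, by omega⟩ (midIdx h x)
  else l (lastIdx h x)

/-- A function of the coordinates, viewed as a function on indices of the direct sum. -/
def pullback (F : Fin n ⊕ Fin N → Fin n ⊕ Fin N → (Fin m → Option (Fin n)) →
    Option (Fin n × Fin n × (Fin m → Fin n)) → ℂ) :
    Tensor (fun i => famV n (m + 2) i ⊕ famW N (m + 2) i) := fun x =>
  F (lowIdx (i := Fin.castSucc 0) (by simp) (x _)) (lowIdx (i := Fin.castSucc 1) (by simp) (x _))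
    (fun k => midIdx (i := k.succ.succ.castSucc) (by simp) (x _))
    (lastIdx (i := Fin.last (m + 2)) (by simp) (x _))

theorem prod_simpleVec (a b : Fin n ⊕ Fin N → ℂ) (p : Fin m → Option (Fin n) → ℂ)
    (l : Option (Fin n × Fin n × (Fin m → Fin n)) → ℂ)
    (x : ∀ i, famV n (m + 2) i ⊕ famW N (m + 2) i) :
    ∏ i, simpleVec a b p l i (x i) =
      pullback (fun i j s e => a i * b j * (∏ k, p k (s k)) * l e) x := by
  rw [Fin.prod_univ_castSucc, Fin.prod_univ_succ, Fin.prod_univ_succ, pullback, ← mul_assoc]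
  congr 1
  · congr 1
    refine prod_congr rfl fun k _ => ?_
    simp [simpleVec]
  · simp [simpleVec]

/-- The direct sum of the two tensors as a function of the coordinates. -/
def sumCoord (i j : Fin n ⊕ Fin N) (s : Fin m → Option (Fin n))
    (e : Option (Fin n × Fin n × (Fin m → Fin n))) : ℂ :=
  e.elim
    (Sum.elim (fun _ => 0) (fun b => Sum.elim (fun _ => 0) (fun b' =>
      if b = b' ∧ s = fun _ => none then 1 else 0) j) i)
    (fun f => Sum.elim (fun a => Sum.elim (fun a' =>
      if a = f.1 ∧ a' = f.2.1 ∧ s = fun k => some (f.2.2 k) then 1 else 0) (fun _ => 0) j)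
      (fun _ => 0) i)

theorem forall_fin_iff {P : Fin (m + 2 + 1) → Prop} : (∀ i, P i) ↔
    P (Fin.castSucc 0) ∧ P (Fin.castSucc 1) ∧ (∀ k : Fin m, P k.succ.succ.castSucc) ∧
      P (Fin.last _) := by
  rw [Fin.forall_fin_succ', Fin.forall_fin_succ, Fin.forall_fin_succ, and_assoc, and_assoc]
  rfl

theorem sumCoord_eq_zero {i j : Fin n ⊕ Fin N} {s : Fin m → Option (Fin n)}
    {e : Option (Fin n × Fin n × (Fin m → Fin n))}
    (hl : ¬ (i.isLeft ∧ j.isLeft ∧ (∀ k, (s k).isSome) ∧ e.isSome))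
    (hr : ¬ (i.isRight ∧ j.isRight ∧ (∀ k, (s k).isNone) ∧ e.isNone)) :
    sumCoord i j s e = 0 := by
  rcases i with a | b <;> rcases j with a' | b' <;> rcases e with _ | f <;>
    simp [sumCoord] at hl hr ⊢
  · rintro _ _ rfl
    simp at hl
  · rintro _ rfl
    simp at hr

section translation

variable {i : Fin (m + 2 + 1)} (x : famV n (m + 2) i ⊕ famW N (m + 2) i)

theorem isLeft_lowIdx (h : (i : ℕ) < 2) : (lowIdx h x).isLeft = x.isLeft := by
  cases x <;> rfl

theorem isRight_lowIdx (h : (i : ℕ) < 2) : (lowIdx h x).isRight = x.isRight := by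
  cases x <;> rfl

theorem isSome_midIdx (h : (i : ℕ) < m + 2) : (midIdx h x).isSome = x.isLeft := by
  cases x <;> rfl

theorem isNone_midIdx (h : (i : ℕ) < m + 2) : (midIdx h x).isNone = x.isRight := by
  cases x <;> rfl

theorem isSome_lastIdx (h : ¬ (i : ℕ) < m + 2) : (lastIdx h x).isSome = x.isLeft := by
  cases x <;> rfl

theorem isNone_lastIdx (h : ¬ (i : ℕ) < m + 2) : (lastIdx h x).isNone = x.isRight := by
  cases x <;> rfl

end translation

theorem dsum_eq_pullback (h : 1 ≤ m + 2) :
    dsum (bigSpider n (m + 2)) (bigMat N (m + 2) h) = pullback sumCoord := by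
  funext x
  by_cases hl : ∀ i, (x i).isLeft
  · choose y hy using fun i => Sum.isLeft_iff.1 (hl i)
    obtain rfl : x = fun i => Sum.inl (y i) := funext hy
    rw [dsum_inl, bigSpider, Fin.prod_univ_succ, Fin.prod_univ_succ]
    simp only [delta, pullback, sumCoord, lowIdx, midIdx, lastIdx, Sum.map_inl, Sum.elim_inl,
      Option.elim_some, Fintype.prod_boole, ite_zero_mul_ite_zero, mul_one, funext_iff,
      Option.some_inj]
    rfl
  by_cases hr : ∀ i, (x i).isRight
  · choose y hy using fun i => Sum.isRight_iff.1 (hr i)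
    obtain rfl : x = fun i => Sum.inr (y i) := funext hy
    rw [dsum_inr, bigMat]
    simp only [delta, pullback, sumCoord, lowIdx, midIdx, lastIdx, Sum.map_inr, Sum.elim_inr,
      Option.elim_none, and_true]
    rfl
  rw [dsum_eq_zero _ _ hl hr]
  rw [forall_fin_iff] at hl hr
  refine (sumCoord_eq_zero (mt ?_ hl) (mt ?_ hr)).symm <;> rintro ⟨h₀, h₁, h₂, h₃⟩
  · exact ⟨(isLeft_lowIdx _ _).symm.trans h₀, (isLeft_lowIdx _ _).symm.trans h₁,
      fun k => (isSome_midIdx _ _).symm.trans (h₂ k), (isSome_lastIdx _ _).symm.trans h₃⟩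
  · exact ⟨(isRight_lowIdx _ _).symm.trans h₀, (isRight_lowIdx _ _).symm.trans h₁,
      fun k => (isNone_midIdx _ _).symm.trans (h₂ k), (isNone_lastIdx _ _).symm.trans h₃⟩

end coordinates

section approximation

variable {n N m : ℕ}

theorem prod_affineCoord_smul (t : ℂ) (z : Fin n → ℂ) (s : Fin m → Option (Fin n)) :
    ∏ k, affineCoord (t • z) (s k) =
      t ^ #{k | s k ≠ none} * ∏ k, affineCoord z (s k) := by
  rw [← prod_const, prod_filter, ← prod_mul_distrib]
  refine prod_congr rfl fun k _ => ?_
  cases h : s k <;> simp [affineCoord]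

/-- A one-parameter family of tensors, as functions of the coordinates, degenerating to the direct
sum. -/
def approx {Q : Type*} [Fintype Q] (z : Q → Fin n → ℂ) (z₀ : Fin n → ℂ) (c : Q → ℂ)
    (R : Finset (Fin m → Fin n)) (q : Q → (Fin m → Fin n) → ℂ) (h : R → (Fin m → Fin n) → ℂ)
    (u v : Fin n → Fin n → Q → Fin N → ℂ) (N₀ : ℕ) (t : ℂ) (i j : Fin n ⊕ Fin N)
    (s : Fin m → Option (Fin n)) (e : Option (Fin n × Fin n × (Fin m → Fin n))) : ℂ :=
  (∑ x : Fin n, ∑ y : Fin n, ∑ J,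
    Sum.elim (fun a => if a = x then 1 else 0) (fun b => t ^ (m + 1) * u x y J b) i *
    Sum.elim (fun a => if a = y then 1 else 0) (fun b => t ^ (m + 1) * (v x y J b / c J)) j *
    (∏ k, affineCoord (t • z J) (s k)) *
    e.elim ((t ^ (2 * m + 2))⁻¹ * c J)
      (fun f => (t ^ m)⁻¹ * (if f.1 = x ∧ f.2.1 = y then 1 else 0) * q J f.2.2)) +
  Sum.elim (fun _ => 1) (fun _ => 0) i * Sum.elim (fun _ => 1) (fun _ => 0) j *
    (∏ k, affineCoord (t • z₀) (s k)) * e.elim (-(t ^ (2 * m + 2))⁻¹) (fun _ => 0) +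
  (∑ x : Fin n, ∑ y : Fin n, ∑ r : R,
    Sum.elim (fun a => if a = x then 1 else 0) (fun _ => 0) i *
    Sum.elim (fun a => if a = y then 1 else 0) (fun _ => 0) j *
    (∏ k, if s k = some (r.1 k) then 1 else 0) *
    e.elim 0 (fun f => (if f.1 = x ∧ f.2.1 = y then 1 else 0) * h r f.2.2)) +
  ∑ b₀ : {b : Fin N // N₀ ≤ b},
    Sum.elim (fun _ => 0) (fun b => if b = b₀.1 then 1 else 0) i *
    Sum.elim (fun _ => 0) (fun b => if b = b₀.1 then 1 else 0) j *
    (∏ k, if s k = none then 1 else 0) * e.elim 1 (fun _ => 0)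

variable {Q : Type*} [Fintype Q] {z : Q → Fin n → ℂ} {z₀ : Fin n → ℂ} {c : Q → ℂ}
    {R : Finset (Fin m → Fin n)} {q : Q → (Fin m → Fin n) → ℂ} {h : R → (Fin m → Fin n) → ℂ}
    {u v : Fin n → Fin n → Q → Fin N → ℂ} {N₀ : ℕ}

theorem approx_eq (hc : ∀ J, c J ≠ 0)
    (hz₀ : ∀ s : Fin m → Option (Fin n),
      ∑ J, c J * ∏ k, affineCoord (z J) (s k) = ∏ k, affineCoord z₀ (s k))
    (hq₀ : ∀ (s : Fin m → Option (Fin n)) (y : Fin m → Fin n), (∃ k, s k = none) →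
      ∑ J, q J y * ∏ k, affineCoord (z J) (s k) = 0)
    (hq : ∀ w y : Fin m → Fin n, ∑ J, q J y * ∏ k, z J (w k) +
      ∑ r : R, (if w = r then 1 else 0) * h r y = if w = y then 1 else 0)
    (hu : ∀ y J b, ∑ x, u x y J b = 0) (hv : ∀ x J b, ∑ y, v x y J b = 0)
    (huv : ∀ b b', ∑ x, ∑ y, ∑ J, u x y J b * v x y J b' =
      if b = b' ∧ (b : ℕ) < N₀ then 1 else 0)
    (i j : Fin n ⊕ Fin N) (s : Fin m → Option (Fin n))
    (e : Option (Fin n × Fin n × (Fin m → Fin n))) :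
    ∃ (C : ℂ) (l : ℕ), ∀ t ≠ 0, approx z z₀ c R q h u v N₀ t i j s e =
      sumCoord i j s e + C * t ^ (l + 1) := by
  simp only [approx, prod_affineCoord_smul, sumCoord]
  rcases e with _ | ⟨f₀, f₁, f⟩ <;> rcases i with a | b <;> rcases j with a' | b' <;>
    simp only [Sum.elim_inl, Sum.elim_inr, Option.elim_none, Option.elim_some, mul_zero, zero_mul,
      sum_const_zero, add_zero, zero_add, one_mul, mul_one]
  · refine ⟨0, 0, fun t ht => ?_⟩
    simp only [ite_mul, one_mul, zero_mul, sum_ite_irrel, sum_const_zero, sum_ite_eq, mem_univ,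
      if_true]
    rw [← hz₀, mul_sum, sum_mul, ← sum_add_distrib]
    refine sum_eq_zero fun J _ => by ring
  · refine ⟨0, 0, fun t ht => ?_⟩
    simp only [ite_mul, one_mul, zero_mul, sum_ite_irrel, sum_const_zero, sum_ite_eq, mem_univ,
      if_true]
    rw [sum_comm]
    refine sum_eq_zero fun J _ => ?_
    simp_rw [mul_div_assoc', div_mul_eq_mul_div]
    simp [← sum_div, ← mul_sum, ← sum_mul, hv]
  · refine ⟨0, 0, fun t ht => ?_⟩
    simp only [ite_mul, mul_ite, mul_one, zero_mul, mul_zero, sum_ite_irrel,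
      sum_const_zero, sum_ite_eq, mem_univ, if_true]
    rw [sum_comm]
    refine sum_eq_zero fun J _ => ?_
    simp [← mul_sum, ← sum_mul, hu]
  · have key (t : ℂ) (ht : t ≠ 0) : ∑ x : Fin n, ∑ y : Fin n, ∑ J, t ^ (m + 1) * u x y J b *
        (t ^ (m + 1) * (v x y J b' / c J)) *
        (t ^ #{k | s k ≠ none} * ∏ k, affineCoord (z J) (s k)) * ((t ^ (2 * m + 2))⁻¹ * c J) =
        (∑ x : Fin n, ∑ y : Fin n, ∑ J, u x y J b * v x y J b' *
          ∏ k, affineCoord (z J) (s k)) * t ^ #{k | s k ≠ none} := by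
      simp_rw [sum_mul]
      refine sum_congr rfl fun x _ => sum_congr rfl fun y _ => sum_congr rfl fun J _ => ?_
      have := hc J
      field_simp
      ring
    by_cases hs : ∃ k, s k ≠ none
    · obtain ⟨l, hl⟩ : ∃ l, #{k | s k ≠ none} = l + 1 := by
        obtain ⟨k, hk⟩ := hs
        exact Nat.exists_eq_succ_of_ne_zero (card_ne_zero_of_mem (mem_filter.2 ⟨mem_univ k, hk⟩))
      refine ⟨∑ x : Fin n, ∑ y : Fin n, ∑ J, u x y J b * v x y J b' *
        ∏ k, affineCoord (z J) (s k), l, fun t ht => ?_⟩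
      obtain ⟨k, hk⟩ := hs
      rw [key t ht, hl, if_neg, zero_add, add_eq_left]
      · exact sum_eq_zero fun b₀ _ => mul_eq_zero_of_right _ <|
          prod_eq_zero (mem_univ k) (if_neg hk)
      · rintro ⟨-, rfl⟩
        exact hk rfl
    · push Not at hs
      obtain rfl : s = fun _ => none := funext hs
      refine ⟨0, 0, fun t ht => ?_⟩
      rw [key t ht]
      have htail : ∑ b₀ : {b : Fin N // N₀ ≤ b}, ((if b = b₀.1 then 1 else 0) *
          if b' = b₀.1 then 1 else 0 : ℂ) = if b = b' ∧ N₀ ≤ b then 1 else 0 := by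
        simp_rw [ite_zero_mul_ite_zero, mul_one]
        split_ifs with hb
        · obtain ⟨rfl, hb⟩ := hb
          rw [sum_eq_single ⟨b, hb⟩] <;> simp +contextual [Subtype.ext_iff, eq_comm]
        · refine sum_eq_zero fun b₀ _ => if_neg ?_
          rintro ⟨rfl, rfl⟩
          exact hb ⟨rfl, b₀.2⟩
      simp only [affineCoord, Option.elim_none, prod_const_one, mul_one, ne_eq, not_true_eq_false,
        filter_false, card_empty, pow_zero, huv, if_true, htail, and_true, zero_mul, add_zero]
      rcases lt_or_ge (b : ℕ) N₀ with hb | hb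
      · simp [hb, hb.not_ge]
      · simp [hb, hb.not_gt]
  · refine ⟨0, 0, fun t ht => ?_⟩
    rw [zero_mul, add_zero, sum_eq_single a, sum_eq_single a', sum_eq_single a, sum_eq_single a']
    · simp only [if_true, one_mul]
      by_cases hf : f₀ = a ∧ f₁ = a'
      · obtain ⟨rfl, rfl⟩ := hf
        simp only [and_self, if_true, true_and, mul_one, one_mul]
        by_cases hs : ∃ k, s k = none
        · have hs' (w : Fin m → Fin n) : ∏ k, (if s k = some (w k) then (1 : ℂ) else 0) = 0 := by
            obtain ⟨k, hk⟩ := hs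
            exact prod_eq_zero (mem_univ k) (if_neg (by simp [hk]))
          rw [if_neg]
          · have hJ (J : Q) : t ^ #{k | s k ≠ none} * (∏ k, affineCoord (z J) (s k)) *
                ((t ^ m)⁻¹ * q J f) = t ^ #{k | s k ≠ none} * (t ^ m)⁻¹ *
                  (q J f * ∏ k, affineCoord (z J) (s k)) := by ring
            simp [hs', hJ, ← mul_sum, hq₀ s f hs]
          · rintro rfl
            simp at hs
        · push Not at hs
          choose w hw using fun k => Option.ne_none_iff_exists'.1 (hs k)
          obtain rfl : s = fun k => some (w k) := funext hw
          have hJ (J : Q) : t ^ m * (∏ k, z J (w k)) * ((t ^ m)⁻¹ * q J f) =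
              q J f * ∏ k, z J (w k) := by field_simp
          have hw' (y : Fin m → Fin n) : ((fun k => some (w k)) = fun k => some (y k)) ↔ w = y := by
            simp [funext_iff]
          simp [affineCoord, hJ, Fintype.prod_boole, ← funext_iff, hw', ← hq w f]
      · rw [if_neg fun h' : a = f₀ ∧ a' = f₁ ∧ _ => hf ⟨h'.1.symm, h'.2.1.symm⟩]
        simp [hf]
    all_goals simp +contextual [eq_comm]
  · refine ⟨∑ x : Fin n, ∑ y : Fin n, ∑ J, (if a = x then 1 else 0) * (v x y J b' / c J) *
        (∏ k, affineCoord (z J) (s k)) * ((if f₀ = x ∧ f₁ = y then 1 else 0) * q J f),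
      #{k | s k ≠ none}, fun t ht => ?_⟩
    simp_rw [sum_mul]
    refine sum_congr rfl fun x _ => sum_congr rfl fun y _ => sum_congr rfl fun J _ => ?_
    field_simp
    ring
  · refine ⟨∑ x : Fin n, ∑ y : Fin n, ∑ J, u x y J b * (if a' = y then 1 else 0) *
        (∏ k, affineCoord (z J) (s k)) * ((if f₀ = x ∧ f₁ = y then 1 else 0) * q J f),
      #{k | s k ≠ none}, fun t ht => ?_⟩
    simp_rw [sum_mul]
    refine sum_congr rfl fun x _ => sum_congr rfl fun y _ => sum_congr rfl fun J _ => ?_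
    field_simp
    ring
  · refine ⟨∑ x : Fin n, ∑ y : Fin n, ∑ J, u x y J b * (v x y J b' / c J) *
        (∏ k, affineCoord (z J) (s k)) * ((if f₀ = x ∧ f₁ = y then 1 else 0) * q J f),
      m + 1 + #{k | s k ≠ none}, fun t ht => ?_⟩
    simp_rw [sum_mul]
    refine sum_congr rfl fun x _ => sum_congr rfl fun y _ => sum_congr rfl fun J _ => ?_
    field_simp
    ring

end approximation

theorem hasRankLE_approx {n N m : ℕ} {Q : Type} [Fintype Q] (z : Q → Fin n → ℂ)
    (z₀ : Fin n → ℂ) (c : Q → ℂ) (R : Finset (Fin m → Fin n)) (q : Q → (Fin m → Fin n) → ℂ)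
    (h : R → (Fin m → Fin n) → ℂ) (u v : Fin n → Fin n → Q → Fin N → ℂ) (N₀ : ℕ) (t : ℂ) :
    HasRankLE (pullback (approx z z₀ c R q h u v N₀ t))
      (n ^ 2 * (#R + Fintype.card Q) + 1 + (N - N₀)) := by
  let vec : (Fin n × Fin n × Q) ⊕ Unit ⊕ (Fin n × Fin n × R) ⊕ {b : Fin N // N₀ ≤ b} →
      ∀ i, famV n (m + 2) i ⊕ famW N (m + 2) i → ℂ :=
    Sum.elim (fun w => simpleVec
        (Sum.elim (fun a => if a = w.1 then 1 else 0)
          (fun b => t ^ (m + 1) * u w.1 w.2.1 w.2.2 b))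
        (Sum.elim (fun a => if a = w.2.1 then 1 else 0)
          (fun b => t ^ (m + 1) * (v w.1 w.2.1 w.2.2 b / c w.2.2)))
        (fun _ => affineCoord (t • z w.2.2))
        (fun e => e.elim ((t ^ (2 * m + 2))⁻¹ * c w.2.2) fun f =>
          (t ^ m)⁻¹ * (if f.1 = w.1 ∧ f.2.1 = w.2.1 then 1 else 0) * q w.2.2 f.2.2)) <|
    Sum.elim (fun _ => simpleVec (Sum.elim (fun _ => 1) fun _ => 0)
        (Sum.elim (fun _ => 1) fun _ => 0) (fun _ => affineCoord (t • z₀))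
        (fun e => e.elim (-(t ^ (2 * m + 2))⁻¹) fun _ => 0)) <|
    Sum.elim (fun w => simpleVec (Sum.elim (fun a => if a = w.1 then 1 else 0) fun _ => 0)
        (Sum.elim (fun a => if a = w.2.1 then 1 else 0) fun _ => 0)
        (fun k o => if o = some (w.2.2.1 k) then 1 else 0)
        (fun e => e.elim 0 fun f =>
          (if f.1 = w.1 ∧ f.2.1 = w.2.1 then 1 else 0) * h w.2.2 f.2.2)) <|
      fun b₀ => simpleVec (Sum.elim (fun _ => 0) fun b => if b = b₀.1 then 1 else 0)
        (Sum.elim (fun _ => 0) fun b => if b = b₀.1 then 1 else 0)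
        (fun _ o => if o = none then 1 else 0) (fun e => e.elim 1 fun _ => 0)
  have hcard : Fintype.card {b : Fin N // N₀ ≤ b} = N - N₀ := by
    have h₁ := Fintype.card_subtype_compl fun b : Fin N => (b : ℕ) < N₀
    rw [Fintype.card_fin, Fintype.card_subtype fun b : Fin N => (b : ℕ) < N₀,
      Fin.card_filter_val_lt] at h₁
    simp only [not_lt] at h₁
    omega
  convert HasRankLE.of_fintype vec using 1
  · funext x
    simp only [vec, Fintype.sum_sum_type, Sum.elim_inl, Sum.elim_inr, prod_simpleVec,
      Fintype.sum_prod_type, univ_unique, sum_singleton, pullback, approx, add_assoc]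
  · simp only [Fintype.card_sum, Fintype.card_prod, Fintype.card_fin, Fintype.card_unit,
      Fintype.card_coe, hcard]
    ring

open Filter Topology in
theorem hasBorderRankLE_pullback {n N m r : ℕ}
    {F : ℂ → Fin n ⊕ Fin N → Fin n ⊕ Fin N → (Fin m → Option (Fin n)) →
      Option (Fin n × Fin n × (Fin m → Fin n)) → ℂ}
    {G : Fin n ⊕ Fin N → Fin n ⊕ Fin N → (Fin m → Option (Fin n)) →
      Option (Fin n × Fin n × (Fin m → Fin n)) → ℂ}
    (hF : ∀ t, HasRankLE (pullback (F t)) r)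
    (hFG : ∀ i j s e, ∃ (C : ℂ) (l : ℕ), ∀ t ≠ 0, F t i j s e = G i j s e + C * t ^ (l + 1)) :
    HasBorderRankLE (pullback G) r := by
  refine mem_closure_of_tendsto (f := fun t => pullback (F t)) (b := 𝓝[≠] (0 : ℂ)) ?_
    (Eventually.of_forall hF)
  refine tendsto_pi_nhds.2 fun x => ?_
  obtain ⟨C, l, hC⟩ := hFG (lowIdx (i := Fin.castSucc 0) (by simp) (x _))
    (lowIdx (i := Fin.castSucc 1) (by simp) (x _))
    (fun k => midIdx (i := k.succ.succ.castSucc) (by simp) (x _))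
    (lastIdx (i := Fin.last (m + 2)) (by simp) (x _))
  have hlim : Tendsto (fun t : ℂ => pullback G x + C * t ^ (l + 1)) (𝓝[≠] 0)
      (𝓝 (pullback G x)) := by
    have hcont : Continuous fun t : ℂ => pullback G x + C * t ^ (l + 1) := by fun_prop
    simpa using (hcont.tendsto 0).mono_left nhdsWithin_le_nhds
  refine hlim.congr' ?_
  filter_upwards [self_mem_nhdsWithin] with t ht
  exact (hC t ht).symm

/-- Strict subadditivity of border rank under direct sum for tensors
of every order at least four: for `d ≥ 3` and `2n^{d−1} + n²(n+1)^{d−3} + 1 < N ≤ n^d`,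
`R̲(T₁ ⊕ T₂) < R̲(T₁) + R̲(T₂)`. -/
theorem strict_subadditivity_higher_order (n d N : ℕ) (hd : 3 ≤ d)
    (hN1 : 2 * n ^ (d - 1) + n ^ 2 * (n + 1) ^ (d - 3) + 1 < N) (hN2 : N ≤ n ^ d) :
    borderRank (dsum (bigSpider n d) (bigMat N d (by omega))) <
      borderRank (bigSpider n d) + borderRank (bigMat N d (by omega)) := by
  obtain ⟨k, rfl⟩ := Nat.exists_eq_add_of_le' hd
  obtain ⟨p, rfl⟩ : ∃ p, n = p + 1 := by
    refine Nat.exists_eq_succ_of_ne_zero ?_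
    rintro rfl
    rw [zero_pow (by omega)] at hN2
    omega
  obtain ⟨hL, hM⟩ := choose_bounds (k := k) (by simpa using hN1) hN2
  obtain ⟨z, z₀, c, R, q, h, hc, hz₀, hq₀, hq, hR⟩ := exists_interpolation (p + 1) k
  obtain ⟨u, v, hu, hv, huv⟩ :=
    exists_zero_sum_families p N (Sym (Option (Fin (p + 1))) (k + 1))
  have hbr := hasBorderRankLE_pullback
    (hasRankLE_approx (m := k + 1) z z₀ c R q h u v
      (p ^ 2 * Fintype.card (Sym (Option (Fin (p + 1))) (k + 1))))
    (approx_eq hc hz₀ hq₀ hq hu hv huv)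
  rw [← dsum_eq_pullback (by omega)] at hbr
  refine (Nat.sInf_le hbr).trans_lt ?_
  have h₁ := pow_le_borderRank_bigSpider (p + 1) (k + 3)
  have h₂ := le_borderRank_bigMat N (k + 3) (by omega)
  refine lt_of_lt_of_le ?_ (Nat.add_le_add h₁ h₂)
  simp only [Sym.card_sym_eq_choose, Fintype.card_option, Fintype.card_fin] at hR ⊢
  have e₁ : p + 1 + 1 + k - 1 = p + 1 + k := by omega
  have e₂ : p + 1 + 1 + (k + 1) - 1 = p + 1 + k + 1 := by omega
  rw [e₁, e₂] at hR
  rw [e₂]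
  have hR' := Nat.mul_le_mul_left ((p + 1) ^ 2) hR
  have hpow : (p + 1) ^ 2 * (p + 1) ^ (k + 1) = (p + 1) ^ (k + 3) := by ring
  rw [mul_add _ ((p + 1) ^ (k + 1)), hpow] at hR'
  omega

end
end Subadditivity
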